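/- Let p be an odd prime and (G,q) a nondegenerate metric group with |G| = p^{2k} for some positive integer k. Then ∑_{g∈G} q(g) = p^k or ∑_{g∈G} q(g) = −p^k; equivalently, the central charge of (G,q) is ±1. -/

import Mathlib

/-- The bimultiplicative form associated to a quadratic form `q` on a group:
`b(g,h) = q(g*h) * q(g)⁻¹ * q(h)⁻¹`. -/
def metricForm {G : Type*} [Group G] (q : G → ℂˣ) (g h : G) : ℂˣ :=
  q (g * h) * (q g)⁻¹ * (q h)⁻¹

/-- The form `metricForm q` is symmetric. -/
lemma metricForm_comm {G : Type*} [CommGroup G] (q : G → ℂˣ) (g h : G) :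
    metricForm q g h = metricForm q h g := by
  simp only [metricForm, mul_comm g h, mul_right_comm]

lemma map_mul_eq_metricForm {G : Type*} [Group G] (q : G → ℂˣ) (g h : G) :
    q (g * h) = q g * q h * metricForm q g h := by
  simp only [metricForm]
  rw [mul_assoc (q (g * h)), ← mul_inv, mul_comm (q (g * h)), mul_inv_cancel_left]

section Quadratic

variable {G : Type*} [CommGroup G] {q : G → ℂˣ}

/-- The homomorphism `g ↦ b(g,h)`. -/
def metricFormHom
    (hq2 : ∀ g₁ g₂ h : G, metricForm q (g₁ * g₂) h = metricForm q g₁ h * metricForm q g₂ h)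
    (h : G) : G →* ℂˣ :=
  MonoidHom.mk' (fun g => metricForm q g h) fun g₁ g₂ => hq2 g₁ g₂ h

variable (hq2 : ∀ g₁ g₂ h : G,
  metricForm q (g₁ * g₂) h = metricForm q g₁ h * metricForm q g₂ h)

include hq2

lemma metricForm_pow_left (g h : G) (n : ℕ) :
    metricForm q (g ^ n) h = metricForm q g h ^ n :=
  map_pow (metricFormHom hq2 h) g n

lemma metricForm_inv_left (g h : G) : metricForm q g⁻¹ h = (metricForm q g h)⁻¹ :=
  map_inv (metricFormHom hq2 h) g

lemma metricForm_one_left (h : G) : metricForm q 1 h = 1 :=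
  map_one (metricFormHom hq2 h)

lemma quadratic_map_one : q 1 = 1 := by
  have h := metricForm_one_left hq2 1
  simpa [metricForm] using h

variable (hq1 : ∀ g : G, q g⁻¹ = q g)

include hq1

lemma metricForm_self (g : G) : metricForm q g g = q g ^ 2 := by
  have h := metricForm_inv_left hq2 g g
  rw [← inv_inj, ← h, metricForm, inv_mul_cancel, quadratic_map_one hq2, hq1, one_mul, sq, mul_inv]

lemma quadratic_map_pow (g : G) (n : ℕ) : q (g ^ n) = q g ^ n ^ 2 := by
  induction n with
  | zero => simpa using quadratic_map_one hq2
  | succ n ih =>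
    rw [pow_succ, map_mul_eq_metricForm q, ih, metricForm_pow_left hq2, metricForm_self hq2 hq1,
      ← pow_mul, ← pow_succ, ← pow_add]
    congr 1
    ring

lemma quadratic_pow_two_mul_card [Fintype G] (g : G) : q g ^ (2 * Fintype.card G) = 1 := by
  rw [pow_mul, ← metricForm_self hq2 hq1, ← metricForm_pow_left hq2, pow_card_eq_one,
    metricForm_one_left hq2]

/-- Rotation by `(a, b)` scales `q ⊕ q` by `a² + b²`. -/
lemma quadratic_rotation (x y : G) (a b : ℕ) :
    q (x ^ a * (y ^ b)⁻¹) * q (x ^ b * y ^ a) = (q x * q y) ^ (a ^ 2 + b ^ 2) := by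
  have h₁ : metricForm q (x ^ a) (y ^ b)⁻¹ = (metricForm q x y ^ (a * b))⁻¹ := by
    rw [metricForm_comm, metricForm_inv_left hq2, metricForm_pow_left hq2, metricForm_comm,
      metricForm_pow_left hq2, ← pow_mul]
  have h₂ : metricForm q (x ^ b) (y ^ a) = metricForm q x y ^ (a * b) := by
    rw [metricForm_comm, metricForm_pow_left hq2, metricForm_comm, metricForm_pow_left hq2,
      ← pow_mul, mul_comm]
  rw [map_mul_eq_metricForm q, map_mul_eq_metricForm q, h₁, h₂, hq1]
  simp only [quadratic_map_pow hq2 hq1]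
  rw [mul_mul_mul_comm, inv_mul_cancel, mul_one, pow_add, mul_pow, mul_pow]
  ac_rfl

end Quadratic

/-- Modulo an odd number `n`, `-1` is a sum of two squares. -/
lemma exists_dvd_sq_add_sq_add_one {n : ℕ} (hn : Odd n) :
    ∃ a b : ℕ, 2 * n ∣ a ^ 2 + b ^ 2 + 1 := by
  have hcop : Nat.Coprime 4 n := Nat.Coprime.pow_left 2 hn.coprime_two_left
  have hn0 : n ≠ 0 := by rintro rfl; simp at hn
  obtain ⟨c, hc4, hcn⟩ := Nat.chineseRemainder hcop 1 (n - 1)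
  have hc : c.Coprime (4 * n) := by
    refine Nat.Coprime.mul_right ?_ ?_
    · exact hc4.gcd_eq.trans (by simp)
    · refine hcn.gcd_eq.trans ?_
      have := (Nat.coprime_self_sub_left (Nat.one_le_iff_ne_zero.2 hn0)).2 (Nat.coprime_one_left n)
      simpa using this
  have : NeZero (4 * n) := ⟨by omega⟩
  obtain ⟨r, -, hr, hrc⟩ := Nat.forall_exists_prime_gt_and_eq_mod
    ((ZMod.isUnit_iff_coprime c (4 * n)).2 hc) 0
  have hrc : r ≡ c [MOD 4 * n] := (ZMod.natCast_eq_natCast_iff _ _ _).1 hrc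
  have hr4 : r ≡ 1 [MOD 4] := (hrc.of_mul_right n).trans hc4
  have hrn : r ≡ n - 1 [MOD n] := (hrc.of_mul_left 4).trans hcn
  have : Fact r.Prime := ⟨hr⟩
  obtain ⟨a, b, hab⟩ := Nat.Prime.sq_add_sq (p := r) (by
    unfold Nat.ModEq at hr4; omega)
  refine ⟨a, b, hab ▸ hn.coprime_two_left.mul_dvd_of_dvd_of_dvd ?_ ?_⟩
  · unfold Nat.ModEq at hr4; omega
  · have h := hrn.add_right 1
    rw [Nat.sub_add_cancel (Nat.one_le_iff_ne_zero.2 hn0)] at h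
    exact (Nat.modEq_zero_iff_dvd).1 (h.trans (by simp [Nat.ModEq]))

section GaussSum

variable {G : Type*} [CommGroup G] [Fintype G] {q : G → ℂˣ}

lemma gauss_sum_mul_sum_inv
    (hq2 : ∀ g₁ g₂ h : G, metricForm q (g₁ * g₂) h = metricForm q g₁ h * metricForm q g₂ h)
    (hnd : ∀ g : G, (∀ h : G, metricForm q g h = 1) → g = 1) :
    (∑ g : G, (q g : ℂ)) * ∑ g : G, (((q g)⁻¹ : ℂˣ) : ℂ) = Fintype.card G := by
  classical
  have key (x : G) : ∑ h : G, (metricForm q h x : ℂ) =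
      if x = 1 then (Fintype.card G : ℂ) else 0 := by
    have h := sum_hom_units ((Units.coeHom ℂ).comp (metricFormHom hq2 x))
    have hx : (Units.coeHom ℂ).comp (metricFormHom hq2 x) = 1 ↔ x = 1 := by
      constructor
      · refine fun h => hnd x fun y => ?_
        have := DFunLike.congr_fun h y
        rw [metricForm_comm]
        exact Units.ext this
      · rintro rfl
        ext y
        change ((metricForm q y 1 : ℂˣ) : ℂ) = 1
        rw [metricForm_comm, metricForm_one_left hq2, Units.val_one]
    simp only [hx] at h
    refine Eq.trans (Finset.sum_congr rfl fun y _ => ?_) (h.trans (by simp))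
    rfl
  calc (∑ g : G, (q g : ℂ)) * ∑ g : G, (((q g)⁻¹ : ℂˣ) : ℂ)
      = ∑ h : G, ∑ g : G, (q g : ℂ) * ((q h)⁻¹ : ℂˣ) := by
        rw [Finset.sum_mul_sum, Finset.sum_comm]
    _ = ∑ h : G, ∑ x : G, (q (h * x) : ℂ) * ((q h)⁻¹ : ℂˣ) :=
        Finset.sum_congr rfl fun h _ => (Equiv.sum_comp (Equiv.mulLeft h) _).symm
    _ = ∑ h : G, ∑ x : G, (q x : ℂ) * metricForm q h x := by
        refine Finset.sum_congr rfl fun h _ => Finset.sum_congr rfl fun x _ => ?_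
        rw [← Units.val_mul, ← Units.val_mul, map_mul_eq_metricForm q, mul_right_comm,
          mul_right_comm (q h), mul_inv_cancel, one_mul]
    _ = Fintype.card G := by
        rw [Finset.sum_comm]
        simp only [← Finset.mul_sum, key]
        simp [quadratic_map_one hq2]

variable (hq1 : ∀ g : G, q g⁻¹ = q g)
  (hq2 : ∀ g₁ g₂ h : G, metricForm q (g₁ * g₂) h = metricForm q g₁ h * metricForm q g₂ h)

include hq1 hq2

lemma gauss_sum_sq_eq_sum_inv_sq (hodd : Odd (Fintype.card G)) :
    (∑ g : G, (q g : ℂ)) ^ 2 = (∑ g : G, (((q g)⁻¹ : ℂˣ) : ℂ)) ^ 2 := by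
  obtain ⟨a, b, hab⟩ := exists_dvd_sq_add_sq_add_one hodd
  have hpow (x : G) : x ^ (a ^ 2 + b ^ 2) = x⁻¹ := by
    rw [eq_inv_iff_mul_eq_one, ← pow_succ]
    exact orderOf_dvd_iff_pow_eq_one.1
      ((orderOf_dvd_card.trans (dvd_mul_left _ 2)).trans hab)
  have hqpow (x : G) : q x ^ (a ^ 2 + b ^ 2) = (q x)⁻¹ := by
    rw [eq_inv_iff_mul_eq_one, ← pow_succ]
    obtain ⟨c, hc⟩ := hab
    rw [hc, pow_mul, quadratic_pow_two_mul_card hq2 hq1, one_pow]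
  let φ : G × G → G × G := fun z => (z.1 ^ a * (z.2 ^ b)⁻¹, z.1 ^ b * z.2 ^ a)
  have hφ : Function.Injective φ := by
    have h₁ (z : G × G) : z.1⁻¹ = (φ z).1 ^ a * (φ z).2 ^ b := by
      rw [← hpow]
      simp only [φ, mul_pow, inv_pow, ← pow_mul]
      rw [mul_comm b a, mul_comm (z.1 ^ (b * b)), mul_assoc, inv_mul_cancel_left, ← pow_add]
      ring_nf
    have h₂ (z : G × G) : z.2⁻¹ = ((φ z).1 ^ b)⁻¹ * (φ z).2 ^ a := by
      rw [← hpow]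
      simp only [φ, mul_pow, inv_pow, ← pow_mul, mul_inv, inv_inv]
      rw [mul_comm b a, mul_comm (z.1 ^ (a * b))⁻¹, mul_assoc, inv_mul_cancel_left, ← pow_add]
      ring_nf
    intro z w h
    refine Prod.ext (inv_injective ?_) (inv_injective ?_)
    · rw [h₁, h₁, h]
    · rw [h₂, h₂, h]
  have hsum := (Equiv.ofBijective φ (Finite.injective_iff_bijective.1 hφ)).sum_comp
    fun z => ((q z.1 * q z.2 : ℂˣ) : ℂ)
  simp only [Equiv.ofBijective_apply, φ, quadratic_rotation hq2 hq1, mul_pow, hqpow] at hsum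
  simp only [Units.val_mul, Fintype.sum_prod_type] at hsum
  rw [sq, sq, Finset.sum_mul_sum, Finset.sum_mul_sum, hsum]

/-- The Gauss sum of a quadratic form on a group of odd order is congruent to `1` modulo `2`. -/
lemma gauss_sum_eq_one_add_two_mul (hodd : Odd (Fintype.card G)) :
    ∃ t : ℂ, IsIntegral ℤ t ∧ ∑ g : G, (q g : ℂ) = 1 + 2 * t := by
  classical
  have hint (g : G) : IsIntegral ℤ (q g : ℂ) := by
    refine IsIntegral.of_pow (n := 2 * Fintype.card G) (by have := hodd.pos; omega) ?_
    rw [← Units.val_pow_eq_pow_val, quadratic_pow_two_mul_card hq2 hq1]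
    exact isIntegral_one
  let f : G → integralClosure ℤ ℂ := fun g => ⟨q g, hint g⟩
  have hf : ∑ g ∈ Finset.univ.erase (1 : G), f g ∈
      Ideal.span {(2 : integralClosure ℤ ℂ)} := by
    rw [← Ideal.Quotient.eq_zero_iff_mem, map_sum]
    refine Finset.sum_involution (fun g _ => g⁻¹) (fun g _ => ?_) (fun g hg _ h => ?_)
      (fun g hg => ?_) (fun g _ => inv_inv g)
    · have : f g⁻¹ = f g := Subtype.ext (congrArg Units.val (hq1 g))
      rw [this, ← map_add, Ideal.Quotient.eq_zero_iff_mem, ← two_mul]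
      exact Ideal.mul_mem_right _ _ (Ideal.mem_span_singleton_self _)
    · refine (Finset.mem_erase.1 hg).1 ?_
      have h2 : g ^ 2 = 1 := by rw [sq, ← inv_mul_cancel g, h]
      have hd := Nat.dvd_gcd (orderOf_dvd_of_pow_eq_one h2) (orderOf_dvd_card (x := g))
      rwa [hodd.coprime_two_left.gcd_eq_one, Nat.dvd_one, orderOf_eq_one_iff] at hd
    · simpa using hg
  obtain ⟨t, ht⟩ := Ideal.mem_span_singleton'.1 hf
  refine ⟨t, t.2, ?_⟩
  have ht' : (t : ℂ) * 2 = ∑ g ∈ Finset.univ.erase (1 : G), (q g : ℂ) := by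
    have h := congrArg (algebraMap (integralClosure ℤ ℂ) ℂ) ht
    rw [map_mul, map_sum, map_ofNat] at h
    exact h
  rw [← Finset.add_sum_erase _ _ (Finset.mem_univ (1 : G)), ← ht', quadratic_map_one hq2,
    Units.val_one, mul_comm]

end GaussSum

/-- If `t` is an algebraic integer and `m` is odd, then `(1 + 2t)² ≠ -m²`. -/
lemma one_add_two_mul_sq_ne_neg_sq {t : ℂ} (ht : IsIntegral ℤ t) {m : ℕ} (hm : Odd m) :
    (1 + 2 * t) ^ 2 ≠ -(m : ℂ) ^ 2 := by
  intro h
  have hi : IsIntegral ℤ (algebraMap ℚ ℂ (-(m ^ 2 + 1) / 4)) := by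
    have : algebraMap ℚ ℂ (-(m ^ 2 + 1) / 4) = t ^ 2 + t := by
      simp only [eq_ratCast]
      push_cast
      linear_combination -h / 4
    rw [this]
    exact (ht.pow 2).add ht
  obtain ⟨n, hn⟩ := IsIntegrallyClosed.isIntegral_iff.1
    ((isIntegral_algebraMap_iff (algebraMap ℚ ℂ).injective).1 hi)
  have hn' : 4 * n = -((m : ℤ) ^ 2 + 1) := by
    have : (4 * n : ℚ) = -(m ^ 2 + 1) := by
      rw [eq_intCast] at hn
      rw [hn]
      ring
    exact_mod_cast this
  obtain ⟨j, rfl⟩ := hm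
  push_cast at hn'
  ring_nf at hn'
  omega

/-- Let `p` be an odd prime and `(G,q)` a nondegenerate metric
group with `|G| = p^(2k)`, `k ≥ 1`. Then the Gauss sum `∑ q(g)` equals `p^k` or
`-p^k`; equivalently, the central charge of `(G,q)` is `±1`. -/
theorem odd_prime_square_order_gauss_sum
    {G : Type*} [CommGroup G] [Fintype G] (q : G → ℂˣ)
    (hq1 : ∀ g : G, q g⁻¹ = q g)
    (hq2 : ∀ g₁ g₂ h : G, metricForm q (g₁ * g₂) h = metricForm q g₁ h * metricForm q g₂ h)
    (hnd : ∀ g : G, (∀ h : G, metricForm q g h = 1) → g = 1)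
    (p k : ℕ) (hp : p.Prime) (hodd : Odd p) (hk : 0 < k)
    (hcard : Fintype.card G = p ^ (2 * k)) :
    (∑ g : G, (q g : ℂ)) = (p : ℂ) ^ k ∨ (∑ g : G, (q g : ℂ)) = -(p : ℂ) ^ k := by
  have hG : Odd (Fintype.card G) := hcard ▸ hodd.pow
  have hmul := gauss_sum_mul_sum_inv hq2 hnd
  have hsq := gauss_sum_sq_eq_sum_inv_sq hq1 hq2 hG
  obtain ⟨t, ht, hS⟩ := gauss_sum_eq_one_add_two_mul hq1 hq2 hG
  have hne := one_add_two_mul_sq_ne_neg_sq ht (hodd.pow (n := k))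
  rw [← hS] at hne
  rw [hcard] at hmul
  rw [mul_comm 2 k, pow_mul, Nat.cast_pow, Nat.cast_pow] at hmul
  rw [Nat.cast_pow] at hne
  rcases sq_eq_sq_iff_eq_or_eq_neg.1 hsq with h | h
  · rw [← h, ← sq] at hmul
    exact sq_eq_sq_iff_eq_or_eq_neg.1 hmul
  · refine absurd ?_ hne
    linear_combination (∑ g : G, (q g : ℂ)) * h - hmul
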